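/- arXiv:1709.00446 — 3 statements merged into one kernel-verified Lean document; each statement's English description precedes it below -/
import Mathlib

section
/- Let f : 𝔅_d(n) → 𝔅_d(n) be holomorphic with f(0) = 0, and let X be a d-tuple of n×n complex matrices with Σ_{j=1}^d X_j X_j* = I (a row coisometry, lying on the boundary of 𝔅_d(n)). If the Fréchet derivative of f at 0 satisfies Df(0)(X) = X, then f(z·X) = z·X for every z ∈ ℂ with |z| < 1. -/
open Matrix
open scoped ComplexOrder

attribute [local instance] Matrix.normedAddCommGroup Matrix.normedSpace

/-- The space of `d`-tuples of `n × n` complex matrices. -/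
abbrev MatTuple (d n : ℕ) := Fin d → Matrix (Fin n) (Fin n) ℂ

/-- The free matrix ball at level `n`: strict row contractions. -/
def freeBall (d n : ℕ) : Set (MatTuple d n) :=
  {X | (1 - ∑ j, X j * (X j)ᴴ).PosDef}

/-- The direct sum of two tuples of matrices. -/
def dSum {d n m : ℕ} (X : MatTuple d n) (Y : MatTuple d m) : MatTuple d (n + m) :=
  fun j => Matrix.reindex finSumFinEquiv finSumFinEquiv (Matrix.fromBlocks (X j) 0 0 (Y j))

/-- An nc self-map of the free ball `𝔅_d`. -/
structure NCSelfMap (d : ℕ) where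
  app : ∀ n, MatTuple d n → MatTuple d n
  mapsTo : ∀ n, Set.MapsTo (app n) (freeBall d n) (freeBall d n)
  map_dSum : ∀ {n m : ℕ} (X : MatTuple d n) (Y : MatTuple d m),
    X ∈ freeBall d n → Y ∈ freeBall d m →
    app (n + m) (dSum X Y) = dSum (app n X) (app m Y)
  map_sim : ∀ {n : ℕ} (X : MatTuple d n) (S : Matrix (Fin n) (Fin n) ℂ),
    X ∈ freeBall d n → IsUnit S →
    (fun j => S⁻¹ * X j * S) ∈ freeBall d n →
    app n (fun j => S⁻¹ * X j * S) = fun j => S⁻¹ * app n X j * S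
  holo : ∀ n, DifferentiableOn ℂ (app n) (freeBall d n)

/-- A tuple is generic if its coordinates generate the full matrix algebra. -/
def IsGeneric {d n : ℕ} (X : MatTuple d n) : Prop :=
  Algebra.adjoin ℂ (Set.range X) = ⊤

/-- The homogeneous degree-one linear relations satisfied by the coordinates of `X`. -/
def linRel {d n : ℕ} (X : MatTuple d n) : Set (Fin d → ℂ) :=
  {α | ∑ j, α j • X j = 0}

/-- The scalar point of level `n` associated to a vector in `ℂ^d`. -/
def scalarPt (d n : ℕ) (v : Fin d → ℂ) : MatTuple d n :=
  fun j => v j • (1 : Matrix (Fin n) (Fin n) ℂ)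

/-- The entries of a tuple of matrices, as a vector of a Hilbert space. -/
noncomputable def MatTuple.toEuclidean (d n : ℕ) :
    MatTuple d n →L[ℂ] EuclideanSpace ℂ (Fin d × Fin n × Fin n) :=
  LinearMap.toContinuousLinearMap
    { toFun := fun Y => WithLp.toLp 2 fun p => Y p.1 p.2.1 p.2.2
      map_add' := fun _ _ => rfl
      map_smul' := fun _ _ => rfl }

theorem MatTuple.toEuclidean_apply {d n : ℕ} (Y : MatTuple d n) (p : Fin d × Fin n × Fin n) :
    MatTuple.toEuclidean d n Y p = Y p.1 p.2.1 p.2.2 := rfl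

theorem MatTuple.toEuclidean_injective (d n : ℕ) :
    Function.Injective (MatTuple.toEuclidean d n) := by
  intro Y Z h
  ext j a b
  exact congrArg (fun v : EuclideanSpace ℂ (Fin d × Fin n × Fin n) => v (j, a, b)) h

theorem MatTuple.norm_toEuclidean_sq {d n : ℕ} (Y : MatTuple d n) :
    ((‖MatTuple.toEuclidean d n Y‖ ^ 2 : ℝ) : ℂ) = (∑ j, Y j * (Y j)ᴴ).trace := by
  rw [EuclideanSpace.norm_sq_eq, trace_sum, Fintype.sum_prod_type, Complex.ofReal_sum]
  refine Finset.sum_congr rfl fun j _ => ?_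
  rw [Fintype.sum_prod_type, Complex.ofReal_sum]
  refine Finset.sum_congr rfl fun a _ => ?_
  rw [Complex.ofReal_sum, diag_apply, mul_apply]
  refine Finset.sum_congr rfl fun b _ => ?_
  rw [toEuclidean_apply, conjTranspose_apply, Complex.ofReal_pow]
  exact (Complex.mul_conj' _).symm

theorem norm_toEuclidean_le_of_mem_freeBall {d n : ℕ} {Y : MatTuple d n} (hY : Y ∈ freeBall d n) :
    ‖MatTuple.toEuclidean d n Y‖ ≤ √n := by
  have h := hY.posSemidef.trace_nonneg
  rw [trace_sub, trace_one, Fintype.card_fin, ← MatTuple.norm_toEuclidean_sq, sub_nonneg] at h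
  exact Real.le_sqrt_of_sq_le (by exact_mod_cast h)

theorem norm_toEuclidean_of_coisometry {d n : ℕ} {X : MatTuple d n}
    (hX : ∑ j, X j * (X j)ᴴ = 1) : ‖MatTuple.toEuclidean d n X‖ = √n := by
  have h := MatTuple.norm_toEuclidean_sq X
  rw [hX, trace_one, Fintype.card_fin] at h
  rw [← Real.sqrt_sq (norm_nonneg (MatTuple.toEuclidean d n X))]
  congr 1
  exact_mod_cast h

theorem smul_mem_freeBall_of_coisometry {d n : ℕ} {X : MatTuple d n}
    (hX : ∑ j, X j * (X j)ᴴ = 1) {z : ℂ} (hz : ‖z‖ < 1) : z • X ∈ freeBall d n := by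
  have h : (1 : Matrix (Fin n) (Fin n) ℂ) - ∑ j, (z • X) j * ((z • X) j)ᴴ
      = ((1 - ‖z‖ ^ 2 : ℝ) : ℂ) • (1 : Matrix (Fin n) (Fin n) ℂ) := by
    have (j : Fin d) : (z • X) j * ((z • X) j)ᴴ = ((‖z‖ ^ 2 : ℝ) : ℂ) • (X j * (X j)ᴴ) := by
      rw [Pi.smul_apply, conjTranspose_smul, smul_mul_smul_comm]
      simp [Complex.mul_conj']
    simp_rw [this]
    rw [← Finset.smul_sum, hX, Complex.ofReal_sub, sub_smul, Complex.ofReal_one, one_smul]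
  rw [freeBall, Set.mem_ofPred_eq, h]
  refine PosDef.one.smul ?_
  have : 0 < 1 - ‖z‖ ^ 2 := by nlinarith [norm_nonneg z]
  exact_mod_cast this

/-- if the derivative at `0` of a holomorphic self-map of a level of the free
ball fixing `0` fixes a row coisometry `X`, then the whole disc through `X` is fixed. -/
theorem stmt_1 {d n : ℕ} (hd : 0 < d) (hn : 0 < n)
    (f : MatTuple d n → MatTuple d n)
    (hmaps : Set.MapsTo f (freeBall d n) (freeBall d n))
    (hf : DifferentiableOn ℂ f (freeBall d n))
    (hf0 : f 0 = 0)
    (X : MatTuple d n) (hX : ∑ j, X j * (X j)ᴴ = 1)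
    (hDf : fderiv ℂ f 0 X = X) :
    ∀ z : ℂ, ‖z‖ < 1 → f (z • X) = z • X := by
  have hnorm := norm_toEuclidean_of_coisometry hX
  have hX0 : X ≠ 0 := by
    rintro rfl
    rw [map_zero, norm_zero] at hnorm
    have : 0 < √(n : ℝ) := by positivity
    exact this.ne hnorm
  have hf_zero : DifferentiableAt ℂ f 0 := by
    by_contra h
    rw [fderiv_zero_of_not_differentiableAt h] at hDf
    exact hX0 hDf.symm
  let F : ℂ → EuclideanSpace ℂ (Fin d × Fin n × Fin n) :=
    fun z => MatTuple.toEuclidean d n (f (z • X))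
  have hmem : ∀ z ∈ Metric.ball (0 : ℂ) 1, z • X ∈ freeBall d n := fun z hz =>
    smul_mem_freeBall_of_coisometry hX (by simpa using hz)
  have hF0 : F 0 = 0 := by simp [F, hf0]
  have hF : DifferentiableOn ℂ F (Metric.ball 0 1) :=
    (MatTuple.toEuclidean d n).differentiable.comp_differentiableOn
      (hf.comp (differentiable_id.smul_const X).differentiableOn hmem)
  have hFmaps : Set.MapsTo F (Metric.ball 0 1) (Metric.closedBall (F 0) √n) := by
    intro z hz
    rw [hF0, mem_closedBall_zero_iff]
    exact norm_toEuclidean_le_of_mem_freeBall (hmaps (hmem z hz))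
  have hline : HasDerivAt (fun z : ℂ => z • X) X 0 :=
    ((hasDerivAt_id (0 : ℂ)).smul_const X).congr_deriv (one_smul ℂ X)
  have hderiv : deriv F 0 = MatTuple.toEuclidean d n X := by
    have h : HasFDerivAt f (fderiv ℂ f 0) ((0 : ℂ) • X) := by
      rw [zero_smul]
      exact hf_zero.hasFDerivAt
    have h' := h.comp_hasDerivAt (0 : ℂ) hline |>.congr_deriv hDf
    exact ((MatTuple.toEuclidean d n).hasFDerivAt.comp_hasDerivAt (0 : ℂ) h').deriv
  have haff := Complex.affine_of_mapsTo_ball_of_norm_dslope_eq_div hF hFmaps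
    (Metric.mem_ball_self one_pos) (by rw [dslope_same, hderiv, hnorm, div_one])
  intro z hz
  apply MatTuple.toEuclidean_injective d n
  have h := haff (show z ∈ Metric.ball (0 : ℂ) 1 by simpa using hz)
  simpa [hF0, hderiv, F] using h
end

section
/- Let f be an nc self-map of 𝔅_d with f₁(0) = 0. If there exist n ≥ 1 and a nonzero n×n complex matrix X such that the point (X,0,…,0) lies in 𝔅_d(n) and f_n(X,0,…,0) = (X,0,…,0), then for every m ≥ 1 and every m×m complex matrix Z with (Z,0,…,0) ∈ 𝔅_d(m), one has f_m(Z,0,…,0) = (Z,0,…,0). -/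
open Matrix
open scoped ComplexOrder

attribute [local instance] Matrix.normedAddCommGroup Matrix.normedSpace

section LinearAlgebra

lemma posDef_fromBlocks_diagonal {m n : Type*} [Fintype m] [Fintype n]
    {A : Matrix m m ℂ} {B : Matrix n n ℂ} (hA : A.PosDef) (hB : B.PosDef) :
    (fromBlocks A 0 0 B).PosDef := by
  refine .of_dotProduct_mulVec_pos (by
    simp [IsHermitian, fromBlocks_conjTranspose, hA.isHermitian.eq, hB.isHermitian.eq]) ?_
  intro x hx
  have key : star x ⬝ᵥ (fromBlocks A 0 0 B *ᵥ x) =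
      star (x ∘ Sum.inl) ⬝ᵥ (A *ᵥ (x ∘ Sum.inl)) +
        star (x ∘ Sum.inr) ⬝ᵥ (B *ᵥ (x ∘ Sum.inr)) := by
    simp [fromBlocks_mulVec, dotProduct]
  rw [key]
  by_cases h : x ∘ Sum.inl = 0
  · refine add_pos_of_nonneg_of_pos (hA.posSemidef.dotProduct_mulVec_nonneg _)
      (hB.dotProduct_mulVec_pos fun h' => hx ?_)
    ext (i | i)
    · exact congrFun h i
    · exact congrFun h' i
  · exact add_pos_of_pos_of_nonneg (hA.dotProduct_mulVec_pos h)
      (hB.posSemidef.dotProduct_mulVec_nonneg _)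

lemma exists_left_eigenvector {m : Type*} [Fintype m] [DecidableEq m] {Z : Matrix m m ℂ} {μ : ℂ}
    (hμ : Z.charpoly.IsRoot μ) : ∃ w : m → ℂ, w ≠ 0 ∧ w ᵥ* Z = μ • w := by
  have h : (scalar m μ - Z).det = 0 := by rw [← eval_charpoly]; exact hμ
  obtain ⟨w, hw0, hw⟩ := exists_vecMul_eq_zero_iff.mpr h
  refine ⟨w, hw0, ?_⟩
  rw [vecMul_sub, sub_eq_zero] at hw
  rw [← hw]
  ext i
  simp [scalar_apply, vecMul_diagonal, mul_comm]

/-- A strict contraction has its (left) eigenvalues in the open unit disc. -/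
lemma norm_lt_one_of_left_eigenvector {m : Type*} [Fintype m] [DecidableEq m] {Z : Matrix m m ℂ}
    (hZ : (1 - Z * Zᴴ).PosDef) {μ : ℂ} {w : m → ℂ} (hw0 : w ≠ 0) (hw : w ᵥ* Z = μ • w) :
    ‖μ‖ < 1 := by
  have h := hZ.dotProduct_mulVec_pos (x := star w) (star_ne_zero.mpr hw0)
  have key : star (star w) ⬝ᵥ ((1 - Z * Zᴴ) *ᵥ star w) =
      (1 - (‖μ‖ : ℂ) ^ 2) * (w ⬝ᵥ star w) := by
    rw [star_star, sub_mulVec, dotProduct_sub, one_mulVec, dotProduct_mulVec, ← vecMul_vecMul,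
      ← dotProduct_mulVec, mulVec_conjTranspose, star_star, hw, star_smul, dotProduct_smul,
      smul_dotProduct, smul_smul, smul_eq_mul, sub_mul, one_mul, ← Complex.conj_mul']
    rfl
  rw [key] at h
  have hpos : 0 < w ⬝ᵥ star w := by
    rw [dotProduct_comm, dotProduct_star_self_pos_iff]; exact hw0
  have h2 := pos_of_mul_pos_left h hpos.le
  have h3 : (0 : ℝ) < 1 - ‖μ‖ ^ 2 := by exact_mod_cast h2
  nlinarith [norm_nonneg μ]

/-- If the characteristic polynomial is separable, the left eigenvectors span. -/
lemma eq_zero_of_forall_left_eigenvector {m : Type*} [Fintype m] [DecidableEq m]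
    {Z M : Matrix m m ℂ} (hZ : Z.charpoly.Separable)
    (hM : ∀ (μ : ℂ) (w : m → ℂ), w ≠ 0 → w ᵥ* Z = μ • w → w ᵥ* M = 0) : M = 0 := by
  have hroot (μ : Z.charpoly.rootSet ℂ) : ∃ w : m → ℂ, w ≠ 0 ∧ w ᵥ* Z = (μ : ℂ) • w := by
    apply exists_left_eigenvector
    have := μ.2
    rw [Polynomial.mem_rootSet] at this
    simpa using this.2
  choose w hw0 hw using hroot
  have hli : LinearIndependent ℂ w :=
    Module.End.eigenvectors_linearIndependent Z.vecMulLinear _ w fun μ =>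
      Module.End.hasEigenvector_iff.mpr ⟨Module.End.mem_eigenspace_iff.mpr (hw μ), hw0 μ⟩
  have hcard : Fintype.card (Z.charpoly.rootSet ℂ) = Module.finrank ℂ (m → ℂ) := by
    rw [Polynomial.card_rootSet_eq_natDegree hZ (IsAlgClosed.splits _), charpoly_natDegree_eq_dim,
      Module.finrank_fintype_fun_eq_card]
  by_cases hm : IsEmpty m
  · ext i; exact hm.elim i
  rw [not_isEmpty_iff] at hm
  have : Nonempty (Z.charpoly.rootSet ℂ) := by
    rw [← Fintype.card_pos_iff, hcard]; simp [Fintype.card_pos]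
  have hspan := hli.span_eq_top_of_card_eq_finrank hcard
  have h0 : M.vecMulLinear = 0 := by
    refine LinearMap.ext_on_range hspan fun μ => ?_
    simpa using hM _ _ (hw0 μ) (hw μ)
  ext i j
  have := congrFun (LinearMap.congr_fun h0 (Pi.single i 1)) j
  simpa using this

/-- A nonzero complex matrix has a nonzero (left) eigenvalue or a (left) Jordan chain of
length two for the eigenvalue zero. -/
lemma exists_left_eigenvector_or_chain {n : Type*} [Fintype n] [DecidableEq n] {X : Matrix n n ℂ}
    (hX : X ≠ 0) :
    (∃ (μ : ℂ) (w : n → ℂ), μ ≠ 0 ∧ w ≠ 0 ∧ w ᵥ* X = μ • w) ∨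
      ∃ w : n → ℂ, w ᵥ* X ≠ 0 ∧ w ᵥ* X ᵥ* X = 0 := by
  by_cases h : ∃ μ, μ ≠ 0 ∧ X.charpoly.IsRoot μ
  · obtain ⟨μ, hμ, hr⟩ := h
    obtain ⟨w, hw⟩ := exists_left_eigenvector hr
    exact .inl ⟨μ, w, hμ, hw⟩
  · right
    push Not at h
    have hroots : X.charpoly.roots = Multiset.replicate (Fintype.card n) 0 := by
      rw [Multiset.eq_replicate]
      refine ⟨?_, fun b hb => ?_⟩
      · rw [← charpoly_natDegree_eq_dim X]
        exact (IsAlgClosed.splits X.charpoly).natDegree_eq_card_roots.symm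
      · by_contra hb0
        exact h b hb0 (Polynomial.isRoot_of_mem_roots hb)
    have hcp : X.charpoly = Polynomial.X ^ Fintype.card n := by
      have := (IsAlgClosed.splits X.charpoly).eq_prod_roots_of_monic (charpoly_monic X)
      rw [this, hroots]; simp
    have hnil : X ^ Fintype.card n = 0 := by
      have := aeval_self_charpoly X
      rwa [hcp, map_pow, Polynomial.aeval_X] at this
    have hex : ∃ k, X ^ (k + 2) = 0 := ⟨Fintype.card n, by rw [pow_add, hnil, zero_mul]⟩
    classical
    have hk := Nat.find_spec hex
    have hk' : X ^ (Nat.find hex + 1) ≠ 0 := by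
      rcases hN : Nat.find hex with _ | k
      · simpa using hX
      · exact Nat.find_min hex (m := k) (by omega)
    obtain ⟨i, hi⟩ : ∃ i, (X ^ (Nat.find hex + 1)) i ≠ 0 := by
      by_contra! hc
      exact hk' (funext hc)
    refine ⟨Pi.single i 1 ᵥ* X ^ Nat.find hex, ?_, ?_⟩
    · rw [vecMul_vecMul, ← pow_succ, single_one_vecMul]
      exact hi
    · rw [vecMul_vecMul, vecMul_vecMul, ← sq, ← pow_add, hk, vecMul_zero]

/-- Along a segment starting at a matrix with separable characteristic polynomial, the
characteristic polynomial is separable for all but finitely many parameters. -/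
lemma finite_not_separable_charpoly {m : Type*} [Fintype m] [DecidableEq m]
    (Z D : Matrix m m ℂ) (hD : D.charpoly.Separable) :
    {s : ℂ | ¬ (D + s • (Z - D)).charpoly.Separable}.Finite := by
  let P : Matrix m m (Polynomial ℂ) :=
    D.map Polynomial.C + (Polynomial.X : Polynomial ℂ) • (Z - D).map Polynomial.C
  let N := Fintype.card m
  let R : Polynomial ℂ := Polynomial.resultant P.charpoly (Polynomial.derivative P.charpoly) N (N - 1)
  have heval (s : ℂ) : P.map (Polynomial.evalRingHom s) = D + s • (Z - D) := by
    ext i j; simp [P]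
  have hR (s : ℂ) : R.eval s = 0 ↔ ¬ (D + s • (Z - D)).charpoly.Separable := by
    have h1 : R.eval s = Polynomial.resultant (D + s • (Z - D)).charpoly
        (Polynomial.derivative (D + s • (Z - D)).charpoly) := by
      have : R.eval s = Polynomial.evalRingHom s R := rfl
      rw [this, ← Polynomial.resultant_map_map, ← Polynomial.derivative_map, ← charpoly_map, heval,
        Polynomial.natDegree_derivative, charpoly_natDegree_eq_dim]
    rw [h1, Polynomial.resultant_eq_zero_iff, Polynomial.Separable]
    exact and_iff_right (.inl (charpoly_monic _).ne_zero)
  have hR0 : R ≠ 0 := by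
    intro h0
    have := (hR 0).mp (by simp [h0])
    simp [hD] at this
  refine (Polynomial.finite_setOfPred_isRoot hR0).subset fun s hs => ?_
  exact (hR s).mpr hs

lemma charpoly_diagonal_separable {m : Type*} [Fintype m] [DecidableEq m] {v : m → ℂ}
    (hv : Function.Injective v) : (diagonal v).charpoly.Separable := by
  rw [charpoly_diagonal]
  exact Polynomial.separable_prod_X_sub_C_iff.mpr hv

end LinearAlgebra

/-- The tuple whose first coordinate is `Z` and whose other coordinates vanish. -/
def firstPt (d : ℕ) {n : ℕ} (Z : Matrix (Fin n) (Fin n) ℂ) : MatTuple d n :=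
  fun j => if (j : ℕ) = 0 then Z else 0

lemma firstPt_smul {d n : ℕ} (z : ℂ) (Z : Matrix (Fin n) (Fin n) ℂ) :
    firstPt d (z • Z) = z • firstPt d Z := by
  ext1 j
  by_cases hj : (j : ℕ) = 0 <;> simp [firstPt, hj]

lemma firstPt_zero {d n : ℕ} : firstPt d (0 : Matrix (Fin n) (Fin n) ℂ) = 0 := by
  ext1 j
  simp [firstPt]

lemma continuous_firstPt {d n : ℕ} :
    Continuous (firstPt d : Matrix (Fin n) (Fin n) ℂ → MatTuple d n) := by
  refine continuous_pi fun j => ?_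
  by_cases hj : (j : ℕ) = 0
  · simpa [firstPt, hj] using continuous_id'
  · simpa [firstPt, hj] using continuous_const

section FreeBall

lemma firstPt_mem_freeBall {d n : ℕ} (hd : 0 < d) {Z : Matrix (Fin n) (Fin n) ℂ} :
    firstPt d Z ∈ freeBall d n ↔ (1 - Z * Zᴴ).PosDef := by
  have : ∑ j, firstPt d Z j * (firstPt d Z j)ᴴ = Z * Zᴴ := by
    rw [Finset.sum_eq_single ⟨0, hd⟩]
    · simp [firstPt]
    · intro j _ hj
      have : (j : ℕ) ≠ 0 := fun h => hj (Fin.ext h)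
      simp [firstPt, this]
    · simp
  simp [freeBall, this]

lemma dSum_mem_freeBall {d n m : ℕ} {X : MatTuple d n} {Y : MatTuple d m}
    (hX : X ∈ freeBall d n) (hY : Y ∈ freeBall d m) : dSum X Y ∈ freeBall d (n + m) := by
  have key : 1 - ∑ j, dSum X Y j * (dSum X Y j)ᴴ =
      (fromBlocks (1 - ∑ j, X j * (X j)ᴴ) 0 0 (1 - ∑ j, Y j * (Y j)ᴴ)).submatrix
        finSumFinEquiv.symm finSumFinEquiv.symm := by
    have h1 : (1 : Matrix (Fin (n + m)) (Fin (n + m)) ℂ) =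
        (1 : Matrix (Fin n ⊕ Fin m) (Fin n ⊕ Fin m) ℂ).submatrix
          finSumFinEquiv.symm finSumFinEquiv.symm := (submatrix_one_equiv _).symm
    have h2 (j : Fin d) : dSum X Y j * (dSum X Y j)ᴴ =
        (fromBlocks (X j * (X j)ᴴ) 0 0 (Y j * (Y j)ᴴ)).submatrix
          finSumFinEquiv.symm finSumFinEquiv.symm := by
      simp [dSum, fromBlocks_conjTranspose, fromBlocks_multiply, submatrix_mul_equiv]
    ext a b
    obtain ⟨a, rfl⟩ := finSumFinEquiv.surjective a
    obtain ⟨b, rfl⟩ := finSumFinEquiv.surjective b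
    rw [h1, ← fromBlocks_one]
    simp only [h2, Matrix.sub_apply, Matrix.sum_apply, submatrix_apply, Equiv.symm_apply_apply]
    rcases a with i | i <;> rcases b with k | k <;> simp [Matrix.sum_apply]
  change Matrix.PosDef _
  rw [key]
  exact (posDef_fromBlocks_diagonal hX hY).submatrix finSumFinEquiv.symm.injective

/-- Strict contractions are closed under convex combinations. -/
lemma posDef_one_sub_mul_conjTranspose_convex {m : Type*} [Fintype m] [DecidableEq m]
    {A B : Matrix m m ℂ} (hA : (1 - A * Aᴴ).PosDef) (hB : (1 - B * Bᴴ).PosDef) {s : ℝ}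
    (hs0 : 0 < s) (hs1 : s < 1) :
    (1 - (A + (s : ℂ) • (B - A)) * (A + (s : ℂ) • (B - A))ᴴ).PosDef := by
  have h0 : (0 : ℂ) < s := by exact_mod_cast hs0
  have h1 : (0 : ℂ) < 1 - s := by
    have : (0 : ℝ) < 1 - s := by linarith
    exact_mod_cast this
  have hAB := (posSemidef_self_mul_conjTranspose (A - B)).smul (mul_pos h1 h0).le
  convert ((hA.smul h1).add (hB.smul h0)).add_posSemidef hAB using 1
  simp only [conjTranspose_add, conjTranspose_smul, conjTranspose_sub, Complex.star_def,
    Complex.conj_ofReal, mul_add, add_mul, mul_sub, sub_mul, Matrix.mul_smul, Matrix.smul_mul]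
  module

lemma one_sub_posDef_of_norm_lt_one {z : ℂ} (hz : ‖z‖ < 1) :
    (1 - (z • (1 : Matrix (Fin 1) (Fin 1) ℂ)) * (z • (1 : Matrix (Fin 1) (Fin 1) ℂ))ᴴ).PosDef := by
  have h : (1 - (z • (1 : Matrix (Fin 1) (Fin 1) ℂ)) * (z • (1 : Matrix (Fin 1) (Fin 1) ℂ))ᴴ) =
      diagonal fun _ => ((1 - ‖z‖ ^ 2 : ℝ) : ℂ) := by
    ext i j
    fin_cases i; fin_cases j
    simp [Complex.conj_mul']
  rw [h]
  refine .diagonal fun _ => ?_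
  have : 0 < 1 - ‖z‖ ^ 2 := by nlinarith [norm_nonneg z]
  exact_mod_cast this

lemma norm_lt_one_of_mem_freeBall_one {d : ℕ} {Y : MatTuple d 1} (hY : Y ∈ freeBall d 1) :
    ‖(WithLp.toLp 2 fun j => Y j 0 0 : EuclideanSpace ℂ (Fin d))‖ < 1 := by
  have h := Matrix.PosDef.diag_pos (i := 0) hY
  have h2 : (1 - ∑ j, Y j * (Y j)ᴴ) 0 0 = ((1 - ∑ j, ‖Y j 0 0‖ ^ 2 : ℝ) : ℂ) := by
    simp [mul_apply, Matrix.sum_apply, Complex.mul_conj']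
  rw [h2] at h
  have h3 : (0 : ℝ) < 1 - ∑ j, ‖Y j 0 0‖ ^ 2 := by exact_mod_cast h
  rw [EuclideanSpace.norm_eq, Real.sqrt_lt' one_pos]
  simpa using h3

end FreeBall

namespace NCSelfMap

variable {d : ℕ} (f : NCSelfMap d)

/-- nc maps respect intertwinings. -/
theorem map_intertwine {n m : ℕ} {X : MatTuple d n} {Y : MatTuple d m}
    (hX : X ∈ freeBall d n) (hY : Y ∈ freeBall d m) (T : Matrix (Fin n) (Fin m) ℂ)
    (hT : ∀ j, X j * T = T * Y j) (j : Fin d) : f.app n X j * T = T * f.app m Y j := by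
  let φ := Matrix.reindexAlgEquiv ℂ ℂ (finSumFinEquiv (m := n) (n := m))
  let S := φ (fromBlocks 1 T 0 1)
  let S' := φ (fromBlocks 1 (-T) 0 1)
  have hSS' : S * S' = 1 := by
    rw [← map_mul φ, fromBlocks_multiply]; simp [fromBlocks_one]
  have hinv : S⁻¹ = S' := inv_eq_right_inv hSS'
  have hunit : IsUnit S := .of_mul_eq_one _ hSS'
  have hφ {A : MatTuple d n} {B : MatTuple d m} (j) :
    dSum A B j = φ (fromBlocks (A j) 0 0 (B j)) := rfl
  have hconj : (fun j => S⁻¹ * dSum X Y j * S) = dSum X Y := by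
    ext1 j
    rw [hinv, hφ, ← map_mul φ, ← map_mul φ, fromBlocks_multiply, fromBlocks_multiply]
    simp [hT]
  have hmem := dSum_mem_freeBall hX hY
  have h := f.map_sim (dSum X Y) S hmem hunit (hconj.symm ▸ hmem)
  rw [hconj, f.map_dSum X Y hX hY] at h
  have hj := congrFun h j
  simp only [hφ] at hj
  rw [hinv, ← map_mul φ, ← map_mul φ, fromBlocks_multiply, fromBlocks_multiply] at hj
  have := congrArg toBlocks₁₂ (φ.injective hj)
  simp at this
  rwa [← sub_eq_add_neg, eq_comm, sub_eq_zero] at this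

/-- The entries of the value of an nc map at the scalar point `(z, 0, …, 0)`. -/
noncomputable def disc (z : ℂ) : EuclideanSpace ℂ (Fin d) :=
  WithLp.toLp 2 fun j => f.app 1 (firstPt d (z • 1)) j 0 0

variable {f}

lemma firstPt_scalar_mem (hd : 0 < d) {z : ℂ} (hz : ‖z‖ < 1) :
    firstPt d (z • (1 : Matrix (Fin 1) (Fin 1) ℂ)) ∈ freeBall d 1 :=
  (firstPt_mem_freeBall hd).mpr (one_sub_posDef_of_norm_lt_one hz)

lemma norm_disc_lt_one (hd : 0 < d) {z : ℂ} (hz : ‖z‖ < 1) : ‖f.disc z‖ < 1 :=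
  norm_lt_one_of_mem_freeBall_one (f.mapsTo 1 (firstPt_scalar_mem hd hz))

lemma disc_zero (hf0 : f.app 1 0 = 0) : f.disc 0 = 0 := by
  ext j
  simp [disc, firstPt_zero, hf0]

lemma differentiableOn_disc (hd : 0 < d) :
    DifferentiableOn ℂ f.disc (Metric.ball 0 1) := by
  have hp : Differentiable ℂ fun z : ℂ => firstPt d (z • (1 : Matrix (Fin 1) (Fin 1) ℂ)) := by
    simp only [firstPt_smul]
    exact differentiable_id.smul_const _
  have hc := (f.holo 1).comp hp.differentiableOn
    (s := Metric.ball (0 : ℂ) 1) fun z hz => firstPt_scalar_mem hd (by simpa using hz)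
  rw [differentiableOn_euclidean]
  intro j
  exact differentiableOn_pi.mp (differentiableOn_pi.mp (differentiableOn_pi.mp hc j) 0) 0

/-- The action of an nc map on left eigenvectors. -/
lemma vecMul_app_of_left_eigenvector (hd : 0 < d) {m : ℕ} {Z : Matrix (Fin m) (Fin m) ℂ}
    (hZ : firstPt d Z ∈ freeBall d m) {μ : ℂ} (hμ : ‖μ‖ < 1) {w : Fin m → ℂ}
    (hw : w ᵥ* Z = μ • w) (j : Fin d) :
    w ᵥ* f.app m (firstPt d Z) j = f.disc μ j • w := by
  have := f.map_intertwine (firstPt_scalar_mem hd hμ) hZ (replicateRow (Fin 1) w) (fun k => by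
    by_cases hk : (k : ℕ) = 0
    · simp only [firstPt, hk, if_true, ← replicateRow_vecMul, hw]
      ext a b; simp
    · simp [firstPt, hk]) j
  ext b
  have hb := congrFun (congrFun this 0) b
  rw [← replicateRow_vecMul] at hb
  simpa [mul_apply, disc] using hb.symm

/-- By the Schwarz lemma, an nc self-map whose restriction to the first disc has slope `e₁`
somewhere is the identity on that disc. -/
lemma disc_eq_of_dslope_eq (hd : 0 < d) (hf0 : f.app 1 0 = 0) {z₀ : ℂ} (hz₀ : ‖z₀‖ < 1)
    (h : dslope f.disc 0 z₀ = EuclideanSpace.single ⟨0, hd⟩ 1) {z : ℂ} (hz : ‖z‖ < 1) :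
    f.disc z = z • EuclideanSpace.single ⟨0, hd⟩ 1 := by
  have := Complex.affine_of_mapsTo_ball_of_norm_dslope_eq_div (R₂ := 1) (z₀ := z₀)
    (differentiableOn_disc (f := f) hd) (fun w hw => by
      simpa [disc_zero hf0] using (norm_disc_lt_one hd (by simpa using hw)).le)
    (by simpa using hz₀) (by simp [h]) (show z ∈ Metric.ball 0 1 by simpa using hz)
  simpa [disc_zero hf0, h] using this

lemma firstPt_upper_mem (hd : 0 < d) {z : ℂ} (hz : ‖z‖ < 1 / 2) :
    firstPt d !![z, 1 / 2; 0, 0] ∈ freeBall d 2 := by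
  rw [firstPt_mem_freeBall hd]
  have h : 1 - !![z, 1 / 2; 0, 0] * !![z, 1 / 2; 0, 0]ᴴ =
      diagonal ![((1 - ‖z‖ ^ 2 - 1 / 4 : ℝ) : ℂ), 1] := by
    ext i j
    rw [Matrix.sub_apply, mul_apply, Fin.sum_univ_two]
    fin_cases i <;> fin_cases j <;> simp [Complex.mul_conj']
    ring
  rw [h]
  refine .diagonal fun i => ?_
  have : 0 < 1 - ‖z‖ ^ 2 - 1 / 4 := by nlinarith [norm_nonneg z]
  fin_cases i
  · exact Complex.zero_lt_real.mpr this
  · simp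

/-- The value at `!![z, 1 / 2; 0, 0]` encodes the difference quotient at the origin. -/
lemma dslope_disc_eq (hd : 0 < d) (hf0 : f.app 1 0 = 0) {z : ℂ} (hz : ‖z‖ < 1 / 2) (hz0 : z ≠ 0)
    (j : Fin d) :
    dslope f.disc 0 z j = 2 * f.app 2 (firstPt d !![z, 1 / 2; 0, 0]) j 0 1 := by
  have hmem := firstPt_upper_mem hd hz
  have h0 := congrFun (vecMul_app_of_left_eigenvector (f := f) hd hmem (μ := 0) (w := ![0, 1])
    (by simp) (by ext i; fin_cases i <;> simp [vecMul, dotProduct, Fin.sum_univ_two]) j) 1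
  have h1 := congrFun (vecMul_app_of_left_eigenvector (f := f) hd hmem (μ := z)
    (w := ![1, 1 / (2 * z)]) (by linarith)
    (by ext i; fin_cases i <;> simp [vecMul, dotProduct, Fin.sum_univ_two]; field_simp) j) 1
  simp [vecMul, dotProduct, Fin.sum_univ_two, disc_zero hf0] at h0
  simp [vecMul, dotProduct, Fin.sum_univ_two, h0] at h1
  simp [dslope_of_ne _ hz0, slope_def_module, disc_zero hf0, h1]
  field_simp

lemma dslope_disc_zero (hd : 0 < d) (hf0 : f.app 1 0 = 0) (j : Fin d) :
    dslope f.disc 0 0 j = 2 * f.app 2 (firstPt d !![0, 1 / 2; 0, 0]) j 0 1 := by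
  have hsmall : ∀ᶠ z : ℂ in nhdsWithin 0 {0}ᶜ, ‖z‖ < 1 / 2 := by
    refine Filter.Eventually.filter_mono nhdsWithin_le_nhds ?_
    exact continuous_norm.continuousAt.eventually_lt continuousAt_const (by simp)
  have hdiff : DifferentiableAt ℂ f.disc 0 :=
    (differentiableOn_disc hd).differentiableAt (Metric.ball_mem_nhds 0 one_pos)
  have hleft : Filter.Tendsto (fun z => dslope f.disc 0 z j) (nhdsWithin 0 {0}ᶜ)
      (nhds (dslope f.disc 0 0 j)) := by
    have h1 := (continuousAt_dslope_same.mpr hdiff).tendsto.mono_left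
      (nhdsWithin_le_nhds (s := {0}ᶜ))
    exact ((EuclideanSpace.proj (𝕜 := ℂ) j).continuous.tendsto _).comp h1
  have hpath : Continuous fun z : ℂ => firstPt d !![z, 1 / 2; 0, 0] := by
    refine continuous_firstPt.comp (continuous_matrix fun i k => ?_)
    fin_cases i <;> fin_cases k <;> simp <;> fun_prop
  have hcont : Filter.Tendsto (fun z => f.app 2 (firstPt d !![z, 1 / 2; 0, 0]))
      (nhdsWithin 0 {0}ᶜ) (nhds (f.app 2 (firstPt d !![0, 1 / 2; 0, 0]))) := by
    refine ((f.holo 2).continuousOn _ (firstPt_upper_mem hd (by simp))).tendsto.comp ?_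
    refine tendsto_nhdsWithin_iff.mpr ⟨hpath.continuousAt.tendsto.mono_left nhdsWithin_le_nhds, ?_⟩
    filter_upwards [hsmall] with z hz using firstPt_upper_mem hd hz
  have hright : Filter.Tendsto (fun z => 2 * f.app 2 (firstPt d !![z, 1 / 2; 0, 0]) j 0 1)
      (nhdsWithin 0 {0}ᶜ) (nhds (2 * f.app 2 (firstPt d !![0, 1 / 2; 0, 0]) j 0 1)) :=
    ((tendsto_pi_nhds.mp (tendsto_pi_nhds.mp (tendsto_pi_nhds.mp hcont j) 0) 1)).const_mul 2
  refine tendsto_nhds_unique hleft (hright.congr' ?_)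
  filter_upwards [hsmall, self_mem_nhdsWithin] with z hz hz0
  exact (dslope_disc_eq hd hf0 hz hz0 j).symm

lemma exists_dslope_disc_eq (hd : 0 < d) (hf0 : f.app 1 0 = 0) {n : ℕ}
    {X : Matrix (Fin n) (Fin n) ℂ} (hX0 : X ≠ 0) (hX : firstPt d X ∈ freeBall d n)
    (hfix : f.app n (firstPt d X) = firstPt d X) :
    ∃ z₀ : ℂ, ‖z₀‖ < 1 ∧ dslope f.disc 0 z₀ = EuclideanSpace.single ⟨0, hd⟩ 1 := by
  rcases exists_left_eigenvector_or_chain hX0 with ⟨μ, w, hμ0, hw0, hw⟩ | ⟨w, hw1, hw2⟩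
  · have hμ := norm_lt_one_of_left_eigenvector ((firstPt_mem_freeBall hd).mp hX) hw0 hw
    refine ⟨μ, hμ, ?_⟩
    ext j
    have h := vecMul_app_of_left_eigenvector (f := f) hd hX hμ hw j
    rw [hfix] at h
    rw [dslope_of_ne _ hμ0, slope_def_module, disc_zero hf0]
    by_cases hj : (j : ℕ) = 0
    · obtain rfl : j = ⟨0, hd⟩ := Fin.ext hj
      simp only [firstPt, if_true, hw] at h
      have := smul_left_injective ℂ hw0 h
      simp [← this, hμ0]
    · have hj' : j ≠ ⟨0, hd⟩ := fun h => hj (congrArg Fin.val h)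
      simp only [firstPt, hj, if_false, vecMul_zero] at h
      have := (smul_eq_zero.mp h.symm).resolve_right hw0
      simp [this, hj']
  · refine ⟨0, by simp, ?_⟩
    let J : Matrix (Fin 2) (Fin 2) ℂ := !![0, 1 / 2; 0, 0]
    let T : Matrix (Fin 2) (Fin n) ℂ := of ![w, (2 : ℂ) • (w ᵥ* X)]
    have hT : J * T = T * X := by
      ext a b
      fin_cases a
      · simp [J, T, mul_apply, Fin.sum_univ_two, vecMul, dotProduct]
      · have := congrFun hw2 b
        simp only [vecMul, dotProduct, Pi.zero_apply] at this
        simp [J, T, mul_apply, Fin.sum_univ_two, vecMul, dotProduct, mul_assoc, ← Finset.mul_sum,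
          this]
    have hTk (j : Fin d) : firstPt d J j * T = T * firstPt d X j := by
      by_cases hj : (j : ℕ) = 0 <;> simp [firstPt, hj, hT]
    have hJ : firstPt d J ∈ freeBall d 2 := firstPt_upper_mem hd (by simp)
    have hF (j : Fin d) : f.app 2 (firstPt d J) j = firstPt d J j := by
      have h := f.map_intertwine hJ hX T hTk j
      rw [hfix, ← hTk j, ← sub_eq_zero, ← Matrix.sub_mul] at h
      rw [← sub_eq_zero]
      set M := f.app 2 (firstPt d J) j - firstPt d J j
      have hrow (a : Fin 2) : M a 0 • w + (M a 1 * 2) • (w ᵥ* X) = 0 := by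
        ext b
        have := congrFun (congrFun h a) b
        simpa [T, mul_apply, Fin.sum_univ_two, mul_assoc] using this
      have hcol (a : Fin 2) : M a 0 = 0 ∧ M a 1 = 0 := by
        have h1 := congrArg (· ᵥ* X) (hrow a)
        simp only [add_vecMul, smul_vecMul, hw2, smul_zero, add_zero, zero_vecMul] at h1
        have h2 := (smul_eq_zero.mp h1).resolve_right hw1
        have h3 := hrow a
        rw [h2, zero_smul, zero_add] at h3
        have h4 := (smul_eq_zero.mp h3).resolve_right hw1
        exact ⟨h2, by simpa using h4⟩
      ext a b
      fin_cases b
      · exact (hcol a).1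
      · exact (hcol a).2
    ext j
    rw [dslope_disc_zero hd hf0, hF]
    by_cases hj : (j : ℕ) = 0
    · obtain rfl : j = ⟨0, hd⟩ := Fin.ext hj
      simp [firstPt, J]
    · have hj' : j ≠ ⟨0, hd⟩ := fun h => hj (congrArg Fin.val h)
      simp [firstPt, hj, hj']

lemma app_firstPt_of_separable (hd : 0 < d)
    (hdisc : ∀ z : ℂ, ‖z‖ < 1 → f.disc z = z • EuclideanSpace.single ⟨0, hd⟩ 1) {m : ℕ}
    {Z : Matrix (Fin m) (Fin m) ℂ} (hZ : firstPt d Z ∈ freeBall d m) (hsep : Z.charpoly.Separable) :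
    f.app m (firstPt d Z) = firstPt d Z := by
  ext1 j
  rw [← sub_eq_zero]
  refine eq_zero_of_forall_left_eigenvector hsep fun μ w hw0 hw => ?_
  have hμ := norm_lt_one_of_left_eigenvector ((firstPt_mem_freeBall hd).mp hZ) hw0 hw
  rw [vecMul_sub, vecMul_app_of_left_eigenvector hd hZ hμ hw, hdisc μ hμ, sub_eq_zero]
  by_cases hj : (j : ℕ) = 0
  · obtain rfl : j = ⟨0, hd⟩ := Fin.ext hj
    simp [firstPt, hw]
  · have hj' : j ≠ ⟨0, hd⟩ := fun h => hj (congrArg Fin.val h)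
    simp [firstPt, hj, hj']

theorem app_firstPt (hd : 0 < d)
    (hdisc : ∀ z : ℂ, ‖z‖ < 1 → f.disc z = z • EuclideanSpace.single ⟨0, hd⟩ 1) {m : ℕ}
    {Z : Matrix (Fin m) (Fin m) ℂ} (hZ : firstPt d Z ∈ freeBall d m) :
    f.app m (firstPt d Z) = firstPt d Z := by
  obtain ⟨D, hDsep, hD⟩ : ∃ D : Matrix (Fin m) (Fin m) ℂ,
      D.charpoly.Separable ∧ (1 - D * Dᴴ).PosDef := by
    have hm (i : Fin m) : (0 : ℝ) < m := by exact_mod_cast i.pos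
    refine ⟨diagonal fun i => (((i : ℕ) / m : ℝ) : ℂ), charpoly_diagonal_separable ?_, ?_⟩
    · intro i k hik
      have := (div_left_inj' (hm i).ne').mp (Complex.ofReal_injective hik)
      exact Fin.ext (by exact_mod_cast this)
    · have : (1 : Matrix (Fin m) (Fin m) ℂ) - (diagonal fun i : Fin m => (((i : ℕ) / m : ℝ) : ℂ)) *
          (diagonal fun i : Fin m => (((i : ℕ) / m : ℝ) : ℂ))ᴴ =
          diagonal fun i : Fin m => ((1 - ((i : ℕ) / m) ^ 2 : ℝ) : ℂ) := by
        rw [diagonal_conjTranspose, diagonal_mul_diagonal, ← diagonal_one, diagonal_sub]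
        congr 1
        ext i
        simp [sq]
      rw [this]
      refine .diagonal fun i => Complex.zero_lt_real.mpr ?_
      have h1 : ((i : ℕ) : ℝ) / m < 1 := by
        rw [div_lt_one (hm i)]; exact_mod_cast i.isLt
      have h0 : 0 ≤ ((i : ℕ) : ℝ) / m := by positivity
      nlinarith
  let p : ℝ → MatTuple d m := fun s => firstPt d (D + (s : ℂ) • (Z - D))
  have hp1 : p 1 = firstPt d Z := by simp [p]
  have hpc : Continuous p := continuous_firstPt.comp (by fun_prop)
  have hp : Filter.Tendsto p (nhdsWithin 1 (Set.Iio 1)) (nhds (p 1)) :=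
    hpc.continuousAt.tendsto.mono_left nhdsWithin_le_nhds
  have hmem : ∀ᶠ s in nhdsWithin (1 : ℝ) (Set.Iio 1), p s ∈ freeBall d m := by
    filter_upwards [Ioo_mem_nhdsLT (zero_lt_one' ℝ)] with s hs
    exact (firstPt_mem_freeBall hd).mpr (posDef_one_sub_mul_conjTranspose_convex hD
      ((firstPt_mem_freeBall hd).mp hZ) hs.1 hs.2)
  have hsep : ∀ᶠ s : ℝ in nhdsWithin (1 : ℝ) (Set.Iio 1),
      (D + (s : ℂ) • (Z - D)).charpoly.Separable := by
    have hfin := (finite_not_separable_charpoly Z D hDsep).preimage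
      (Complex.ofReal_injective.injOn (s := _))
    have := (hfin.subset (Set.sdiff_subset (t := {(1 : ℝ)}))).isClosed.isOpen_compl.mem_nhds
      (x := 1) (by simp)
    filter_upwards [mem_nhdsWithin_of_mem_nhds this, self_mem_nhdsWithin] with s hs hs1
    by_contra hc
    exact hs ⟨hc, (Set.mem_Iio.mp hs1).ne⟩
  have hlim : Filter.Tendsto (fun s => f.app m (p s)) (nhdsWithin 1 (Set.Iio 1))
      (nhds (f.app m (p 1))) :=
    ((f.holo m).continuousOn _ (hp1 ▸ hZ)).tendsto.comp (tendsto_nhdsWithin_iff.mpr ⟨hp, hmem⟩)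
  rw [← hp1]
  refine tendsto_nhds_unique hlim (hp.congr' ?_)
  filter_upwards [hmem, hsep] with s hs hs'
  exact (app_firstPt_of_separable hd hdisc hs hs').symm

end NCSelfMap

/-- if an nc self-map of the free ball fixing the origin fixes a nonzero
point supported on the first coordinate, it fixes all points supported on the first
coordinate, on every level. -/
theorem stmt_3 {d : ℕ} (hd : 0 < d) (f : NCSelfMap d) (hf0 : f.app 1 0 = 0)
    {n : ℕ} (hn : 1 ≤ n) (X : Matrix (Fin n) (Fin n) ℂ) (hX0 : X ≠ 0)
    (hXball : (fun j : Fin d => if (j : ℕ) = 0 then X else 0) ∈ freeBall d n)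
    (hfix : f.app n (fun j : Fin d => if (j : ℕ) = 0 then X else 0) =
      fun j : Fin d => if (j : ℕ) = 0 then X else 0) :
    ∀ m : ℕ, 1 ≤ m → ∀ Z : Matrix (Fin m) (Fin m) ℂ,
      (fun j : Fin d => if (j : ℕ) = 0 then Z else 0) ∈ freeBall d m →
      f.app m (fun j : Fin d => if (j : ℕ) = 0 then Z else 0) =
        fun j : Fin d => if (j : ℕ) = 0 then Z else 0 := by
  intro m _ Z hZ
  obtain ⟨z₀, hz₀, h⟩ := NCSelfMap.exists_dslope_disc_eq hd hf0 hX0 hXball hfix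
  exact NCSelfMap.app_firstPt hd (fun z hz => NCSelfMap.disc_eq_of_dslope_eq hd hf0 hz₀ h hz) hZ
end

section
/- Let f be an nc self-map of 𝔅_d and let m be an integer with 2 ≤ m ≤ d. Suppose f fixes every point of 𝔅_d(1) of the form (z_1,…,z_m,0,…,0) (all coordinates beyond the m-th vanish). Then for every n ≥ 1, f_n fixes every point of 𝔅_d(n) of the form (Z_1,…,Z_m,0,…,0). -/
open Matrix
open scoped ComplexOrder

attribute [local instance] Matrix.normedAddCommGroup Matrix.normedSpace

open Filter Topology

/-- The tuples of `n × n` matrices that are (not necessarily strict) row contractions. -/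
def closedFreeBall (d n : ℕ) : Set (MatTuple d n) :=
  {X | (1 - ∑ j, X j * (X j)ᴴ).PosSemidef}

lemma freeBall_subset_closedFreeBall (d n : ℕ) : freeBall d n ⊆ closedFreeBall d n :=
  fun _ hX => Matrix.PosDef.posSemidef hX

lemma smul_mem_freeBall {d n : ℕ} {X : MatTuple d n} (hX : X ∈ closedFreeBall d n) {t : ℂ}
    (ht : ‖t‖ < 1) : t • X ∈ freeBall d n := by
  have h1 : (0 : ℝ) < 1 - ‖t‖ ^ 2 := by nlinarith [norm_nonneg t]
  have key : 1 - ∑ j, (t • X) j * ((t • X) j)ᴴ =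
      (1 - ‖t‖ ^ 2) • (1 : Matrix (Fin n) (Fin n) ℂ) +
        (‖t‖ ^ 2) • (1 - ∑ j, X j * (X j)ᴴ) := by
    have h2 : ∀ j, (t • X) j * ((t • X) j)ᴴ = (‖t‖ ^ 2) • (X j * (X j)ᴴ) := by
      intro j
      rw [Pi.smul_apply, conjTranspose_smul, smul_mul_smul_comm, ← Complex.coe_smul]
      congr 1
      simpa using Complex.mul_conj' t
    simp only [h2]
    rw [← Finset.smul_sum]
    module
  change (1 - ∑ j, (t • X) j * ((t • X) j)ᴴ).PosDef
  rw [key]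
  exact (Matrix.PosDef.one.smul h1).add_posSemidef (Matrix.PosSemidef.smul hX (by positivity))

open scoped MatrixOrder Matrix.Norms.L2Operator in
lemma exists_eq_mul_conjTranspose {n : ℕ} {A : Matrix (Fin n) (Fin n) ℂ} (hA : A.PosSemidef) :
    ∃ b : Matrix (Fin n) (Fin n) ℂ, A = b * bᴴ := by
  obtain ⟨b, hb⟩ := CStarAlgebra.nonneg_iff_eq_star_mul_self.mp hA.nonneg
  exact ⟨bᴴ, by rw [hb, conjTranspose_conjTranspose, star_eq_conjTranspose]⟩

lemma zero_mem_freeBall (d n : ℕ) : (0 : MatTuple d n) ∈ freeBall d n := by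
  simpa [freeBall] using Matrix.PosDef.one

lemma diagonal_mem_freeBall {d n : ℕ} {v : Fin d → Fin n → ℂ}
    (hv : ∀ i, ∑ j, ‖v j i‖ ^ 2 < 1) : (fun j => diagonal (v j)) ∈ freeBall d n := by
  have h : 1 - ∑ j, diagonal (v j) * (diagonal (v j))ᴴ =
      diagonal (fun i => ((1 - ∑ j, ‖v j i‖ ^ 2 : ℝ) : ℂ)) := by
    ext a b
    by_cases hab : a = b
    · subst hab
      simp [Matrix.sum_apply, Complex.mul_conj']
    · simp [Matrix.sum_apply, hab]
  change (1 - ∑ j, diagonal (v j) * (diagonal (v j))ᴴ).PosDef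
  rw [h, posDef_diagonal_iff]
  intro i
  exact_mod_cast sub_pos.2 (hv i)

lemma posDef_one_sub_single {n : ℕ} (a : Fin n) {c : ℂ} (hc : c < 1) :
    (1 - Matrix.single a a c).PosDef := by
  rw [← Matrix.diagonal_single, ← Matrix.diagonal_one, Matrix.diagonal_sub, posDef_diagonal_iff]
  intro i
  by_cases hi : i = a
  · subst hi
    simpa using hc
  · simp [hi]

lemma single_gram {d n : ℕ} (k : Fin d) (M : Matrix (Fin n) (Fin n) ℂ) :
    ∑ j, (Pi.single k M : MatTuple d n) j * ((Pi.single k M : MatTuple d n) j)ᴴ = M * Mᴴ := by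
  rw [Finset.sum_eq_single k]
  · simp
  · intro j _ hj
    simp [Pi.single_eq_of_ne hj]
  · simp

lemma single_mem_freeBall {d n : ℕ} (k : Fin d) {M : Matrix (Fin n) (Fin n) ℂ}
    (hM : (1 - M * Mᴴ).PosDef) : (Pi.single k M : MatTuple d n) ∈ freeBall d n := by
  simpa only [freeBall, Set.mem_ofPred_eq, single_gram] using hM

lemma dSum_diagonal {d n : ℕ} (v : Fin d → Fin (n + 1) → ℂ) :
    dSum (fun j => diagonal (fun i : Fin n => v j i.castSucc))
      (fun j => diagonal (fun _ : Fin 1 => v j (Fin.last n))) = fun j => diagonal (v j) := by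
  funext j
  simp only [dSum, fromBlocks_diagonal, reindex_apply, submatrix_diagonal_equiv]
  congr 1
  funext i
  obtain ⟨x, rfl⟩ := finSumFinEquiv.surjective i
  rcases x with x | x
  · simp [Fin.castSucc]
  · simp only [Function.comp_apply, Equiv.symm_apply_apply, Sum.elim_inr]
    congr 1
    ext
    simp

lemma dSum_left_injective {d n m : ℕ} {X X' : MatTuple d n} {Y Y' : MatTuple d m}
    (h : dSum X Y = dSum X' Y') : X = X' := by
  funext j
  have hj := (Matrix.reindex finSumFinEquiv finSumFinEquiv).injective (congrFun h j)
  exact (fromBlocks_inj.1 hj).1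

namespace NCSelfMap

variable {d m : ℕ} (f : NCSelfMap d)

/-- A map which fixes a path in the free ball also fixes its starting point. -/
lemma app_eq_of_path {n : ℕ} (γ : ℝ → MatTuple d n) (hγ : Continuous γ)
    (hmem : ∀ s ∈ Set.Ico (0 : ℝ) 1, γ s ∈ freeBall d n)
    (hfix : ∀ s ∈ Set.Ioo (0 : ℝ) 1, f.app n (γ s) = γ s) : f.app n (γ 0) = γ 0 := by
  have hev : ∀ᶠ s in 𝓝[>] (0 : ℝ), s ∈ Set.Ioo (0 : ℝ) 1 := Ioo_mem_nhdsGT one_pos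
  have h1 : Tendsto γ (𝓝[>] 0) (𝓝 (γ 0)) := (hγ.tendsto 0).mono_left nhdsWithin_le_nhds
  have h2 : Tendsto γ (𝓝[>] 0) (𝓝[freeBall d n] (γ 0)) :=
    tendsto_nhdsWithin_iff.2 ⟨h1, hev.mono fun s hs => hmem s ⟨hs.1.le, hs.2⟩⟩
  have h3 : Tendsto (fun s => f.app n (γ s)) (𝓝[>] 0) (𝓝 (f.app n (γ 0))) :=
    ((f.holo n).continuousOn (γ 0) (hmem 0 (by simp))).tendsto.comp h2
  exact tendsto_nhds_unique (h3.congr' (hev.mono fun s hs => hfix s hs)) h1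

/-- Fixing the scalar points forces fixing the tuples of diagonal matrices. -/
lemma app_diagonal
    (hfix1 : ∀ v ∈ freeBall d 1, (∀ j : Fin d, m ≤ (j : ℕ) → v j = 0) → f.app 1 v = v) {n : ℕ}
    (v : Fin d → Fin n → ℂ) (hv : ∀ i, ∑ j, ‖v j i‖ ^ 2 < 1)
    (hv0 : ∀ j : Fin d, m ≤ (j : ℕ) → v j = 0) :
    f.app n (fun j => diagonal (v j)) = fun j => diagonal (v j) := by
  induction n with
  | zero => exact Subsingleton.elim _ _
  | succ n ih =>
    have h1 := ih (fun j i => v j i.castSucc) (fun i => hv _)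
      (fun j hj => by funext i; simp [hv0 j hj])
    have hm2 := diagonal_mem_freeBall (v := fun j (_ : Fin 1) => v j (Fin.last n))
      (fun i => hv _)
    have h2 := hfix1 _ hm2 (fun j hj => by simp [hv0 j hj])
    rw [← dSum_diagonal v, f.map_dSum _ _ (diagonal_mem_freeBall fun i => hv _) hm2, h1, h2]

lemma app_zero
    (hfix1 : ∀ v ∈ freeBall d 1, (∀ j : Fin d, m ≤ (j : ℕ) → v j = 0) → f.app 1 v = v) (n : ℕ) :
    f.app n 0 = 0 := by
  have := f.app_diagonal hfix1 (0 : Fin d → Fin n → ℂ) (by simp) (by simp)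
  simpa [← Pi.zero_def] using this

lemma hasDerivAt_ray {n : ℕ} (Z : MatTuple d n) (t : ℂ) : HasDerivAt (fun t : ℂ => t • Z) Z t := by
  have h := (hasDerivAt_id t).smul_const Z
  rw [one_smul] at h
  exact h

lemma hasDerivAt_app_ray {n : ℕ} {Z : MatTuple d n} (hZ : Z ∈ closedFreeBall d n) :
    HasDerivAt (fun t : ℂ => f.app n (t • Z)) (fderivWithin ℂ (f.app n) (freeBall d n) 0 Z) 0 := by
  have hl := (f.holo n 0 (zero_mem_freeBall d n)).hasFDerivWithinAt
  refine hl.comp_hasDerivAt_of_eq (0 : ℂ) (hasDerivAt_ray Z 0) ?_ (by simp)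
  filter_upwards [Metric.ball_mem_nhds (0 : ℂ) one_pos] with t ht
  exact smul_mem_freeBall hZ (by simpa using ht)

/-- The derivative at the origin is the identity in the directions of fixed rays. -/
lemma fderivWithin_zero_of_ray {n : ℕ} {Z : MatTuple d n} (hZ : Z ∈ freeBall d n)
    (hfix : ∀ t : ℂ, ‖t‖ < 1 → f.app n (t • Z) = t • Z) :
    fderivWithin ℂ (f.app n) (freeBall d n) 0 Z = Z := by
  have h1 := f.hasDerivAt_app_ray (freeBall_subset_closedFreeBall d n hZ)
  refine h1.unique ((hasDerivAt_ray Z 0).congr_of_eventuallyEq ?_)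
  filter_upwards [Metric.ball_mem_nhds (0 : ℂ) one_pos] with t ht
  exact hfix t (by simpa using ht)

lemma fderivWithin_zero_single_diag
    (hfix1 : ∀ v ∈ freeBall d 1, (∀ j : Fin d, m ≤ (j : ℕ) → v j = 0) → f.app 1 v = v) {n : ℕ}
    (k : Fin d) (hk : (k : ℕ) < m) (a : Fin n) {S : Matrix (Fin n) (Fin n) ℂ} (hS : IsUnit S)
    (hM : (1 - (2⁻¹ : ℂ) • (S⁻¹ * Matrix.single a a 1 * S) *
      ((2⁻¹ : ℂ) • (S⁻¹ * Matrix.single a a 1 * S))ᴴ).PosDef) :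
    fderivWithin ℂ (f.app n) (freeBall d n) 0 (Pi.single k (S⁻¹ * Matrix.single a a 1 * S)) =
      Pi.single k (S⁻¹ * Matrix.single a a 1 * S) := by
  set E := S⁻¹ * Matrix.single a a 1 * S with hE
  have hmem := single_mem_freeBall k hM
  have h := f.fderivWithin_zero_of_ray hmem (fun t ht => by
    let v : Fin d → Fin n → ℂ := Pi.single k (Pi.single a (t * 2⁻¹))
    have hv : ∀ i, ∑ j, ‖v j i‖ ^ 2 < 1 := by
      intro i
      rw [Finset.sum_eq_single k]
      · by_cases hi : i = a
        · subst hi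
          simp only [v, Pi.single_eq_same, norm_mul, norm_inv, Complex.norm_ofNat]
          nlinarith [norm_nonneg t]
        · simp [v, hi]
      · intro j _ hj
        simp [v, hj]
      · simp
    have hv0 : ∀ j : Fin d, m ≤ (j : ℕ) → v j = 0 := by
      intro j hj
      have : j ≠ k := by rintro rfl; omega
      simp [v, this]
    have hconj : (fun j => S⁻¹ * diagonal (v j) * S) =
        t • (Pi.single k ((2⁻¹ : ℂ) • E) : MatTuple d n) := by
      funext j
      by_cases hj : j = k
      · subst hj
        have : diagonal (v j) = (t * 2⁻¹) • Matrix.single a a (1 : ℂ) := by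
          simp [v, Matrix.diagonal_single, Matrix.smul_single]
        rw [this, mul_smul_comm, smul_mul_assoc, ← hE]
        simp [smul_smul]
      · simp [v, hj]
    have h3 := f.map_sim (fun j => diagonal (v j)) S (diagonal_mem_freeBall hv) hS
      (by rw [hconj]; exact smul_mem_freeBall (freeBall_subset_closedFreeBall d n hmem) ht)
    rw [f.app_diagonal hfix1 v hv hv0, hconj] at h3
    exact h3)
  have h2 : (Pi.single k ((2⁻¹ : ℂ) • E) : MatTuple d n) = (2⁻¹ : ℂ) • Pi.single k E :=
    Pi.single_smul' k _ E
  rw [h2, map_smul] at h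
  exact smul_right_injective _ (by norm_num : (2⁻¹ : ℂ) ≠ 0) h

/-- The derivative at the origin is the identity on the tuples supported on the first `m`
coordinates. -/
lemma fderivWithin_zero
    (hfix1 : ∀ v ∈ freeBall d 1, (∀ j : Fin d, m ≤ (j : ℕ) → v j = 0) → f.app 1 v = v) {n : ℕ}
    (Z : MatTuple d n) (hZ : ∀ j : Fin d, m ≤ (j : ℕ) → Z j = 0) :
    fderivWithin ℂ (f.app n) (freeBall d n) 0 Z = Z := by
  have hdiag : ∀ (k : Fin d) (_ : (k : ℕ) < m) (a : Fin n),
      fderivWithin ℂ (f.app n) (freeBall d n) 0 (Pi.single k (Matrix.single a a 1)) =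
        Pi.single k (Matrix.single a a 1) := by
    intro k hk a
    have h := f.fderivWithin_zero_single_diag hfix1 k hk a (S := 1) isUnit_one
    simp only [inv_one, one_mul, mul_one] at h
    apply h
    have : (2⁻¹ : ℂ) • Matrix.single a a (1 : ℂ) * ((2⁻¹ : ℂ) • Matrix.single a a (1 : ℂ))ᴴ =
        Matrix.single a a ((4⁻¹ : ℝ) : ℂ) := by
      simp [conjTranspose_single, Matrix.smul_single]
      norm_num
    rw [this]
    exact posDef_one_sub_single a (by norm_cast; norm_num)
  have hunit : ∀ (k : Fin d) (_ : (k : ℕ) < m) (a b : Fin n),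
      fderivWithin ℂ (f.app n) (freeBall d n) 0 (Pi.single k (Matrix.single a b 1)) =
        Pi.single k (Matrix.single a b 1) := by
    intro k hk a b
    by_cases hab : a = b
    · subst hab
      exact hdiag k hk a
    have hinv : (transvection a b (1 : ℂ))⁻¹ = transvection a b (-1) := by
      apply inv_eq_left_inv
      rw [transvection_mul_transvection_same _ _ hab]
      simp
    have hS : IsUnit (transvection a b (1 : ℂ)) := by
      rw [isUnit_iff_isUnit_det, det_transvection_of_ne a b hab]
      exact isUnit_one
    have hE : (transvection a b (1 : ℂ))⁻¹ * Matrix.single a a 1 * transvection a b (1 : ℂ) =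
        Matrix.single a a 1 + Matrix.single a b 1 := by
      rw [hinv]
      simp [transvection, add_mul, mul_add, Ne.symm hab]
    have h := f.fderivWithin_zero_single_diag hfix1 k hk a hS
    rw [hE] at h
    have h2 := h (by
      have : (2⁻¹ : ℂ) • (Matrix.single a a (1 : ℂ) + Matrix.single a b 1) *
          ((2⁻¹ : ℂ) • (Matrix.single a a (1 : ℂ) + Matrix.single a b 1))ᴴ =
          Matrix.single a a ((2⁻¹ : ℝ) : ℂ) := by
        simp [conjTranspose_single, Matrix.smul_single, add_mul, mul_add, hab, Ne.symm hab,
          ← Matrix.single_add]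
        norm_num
      rw [this]
      exact posDef_one_sub_single a (by norm_cast; norm_num))
    rw [Pi.single_add, map_add, hdiag k hk a] at h2
    exact add_left_cancel h2
  have hdec : Z = ∑ k, ∑ a, ∑ b, Z k a b • (Pi.single k (Matrix.single a b 1) : MatTuple d n) := by
    conv_lhs => rw [← Finset.univ_sum_single Z]
    refine Finset.sum_congr rfl fun k _ => ?_
    conv_lhs => rw [matrix_eq_sum_single (Z k)]
    simp only [← Pi.single_smul, Matrix.smul_single, smul_eq_mul, mul_one]
    funext j
    by_cases hj : j = k
    · subst hj
      simp [Finset.sum_apply]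
    · simp [Finset.sum_apply, hj]
  conv_lhs => rw [hdec]
  conv_rhs => rw [hdec]
  simp only [map_sum, map_smul]
  refine Finset.sum_congr rfl fun k _ => Finset.sum_congr rfl fun a _ =>
    Finset.sum_congr rfl fun b _ => ?_
  by_cases hk : (k : ℕ) < m
  · rw [hunit k hk]
  · simp [hZ k (not_lt.1 hk)]

end NCSelfMap

/-- The tuples of matrices, seen in the Euclidean space of their entries. -/
noncomputable def toEntries (d n : ℕ) :
    MatTuple d n →L[ℂ] EuclideanSpace ℂ (Fin d × Fin n × Fin n) :=
  LinearMap.toContinuousLinearMap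
    { toFun := fun X => WithLp.toLp 2 fun p => X p.1 p.2.1 p.2.2
      map_add' := fun _ _ => rfl
      map_smul' := fun _ _ => rfl }

lemma toEntries_injective (d n : ℕ) : Function.Injective (toEntries d n) := by
  intro X Y h
  funext j
  ext a b
  exact congrArg (fun x : EuclideanSpace ℂ (Fin d × Fin n × Fin n) => x (j, a, b)) h

lemma trace_sum_mul_conjTranspose {d n : ℕ} (X : MatTuple d n) :
    (∑ j, X j * (X j)ᴴ).trace = ((‖toEntries d n X‖ ^ 2 : ℝ) : ℂ) := by
  rw [EuclideanSpace.norm_sq_eq]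
  have : ∀ p, toEntries d n X p = X p.1 p.2.1 p.2.2 := fun p => rfl
  simp only [this, Fintype.sum_prod_type]
  simp [Matrix.trace, Matrix.sum_apply, Matrix.mul_apply, Complex.mul_conj']
  exact Finset.sum_comm

lemma norm_toEntries_sq_lt {d n : ℕ} (hn : 1 ≤ n) {X : MatTuple d n} (hX : X ∈ freeBall d n) :
    ‖toEntries d n X‖ ^ 2 < n := by
  have : Nonempty (Fin n) := ⟨⟨0, hn⟩⟩
  have h := Matrix.PosDef.trace_pos hX
  rw [trace_sub, trace_sum_mul_conjTranspose, trace_one, Fintype.card_fin] at h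
  exact_mod_cast sub_pos.1 h

namespace NCSelfMap

variable {d m : ℕ} (f : NCSelfMap d)

/-- By the equality case of the Schwarz lemma, rays to row coisometries are fixed. -/
lemma app_smul_coisometry
    (hfix1 : ∀ v ∈ freeBall d 1, (∀ j : Fin d, m ≤ (j : ℕ) → v j = 0) → f.app 1 v = v) {n : ℕ}
    (hn : 1 ≤ n) (Z : MatTuple d n) (hZ : ∀ j : Fin d, m ≤ (j : ℕ) → Z j = 0)
    (hiso : ∑ j, Z j * (Z j)ᴴ = 1) {t : ℂ} (ht : ‖t‖ < 1) : f.app n (t • Z) = t • Z := by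
  have hZc : Z ∈ closedFreeBall d n := by
    simpa [closedFreeBall, hiso] using Matrix.PosSemidef.zero
  have hmem : ∀ t ∈ Metric.ball (0 : ℂ) 1, t • Z ∈ freeBall d n := fun t ht =>
    smul_mem_freeBall hZc (by simpa using ht)
  set φ : ℂ → EuclideanSpace ℂ (Fin d × Fin n × Fin n) :=
    fun t => toEntries d n (f.app n (t • Z)) with hφ
  have hφ0 : φ 0 = 0 := by simp [hφ, f.app_zero hfix1]
  have hder : HasDerivAt φ (toEntries d n Z) 0 := by
    have h1 := f.hasDerivAt_app_ray hZc
    rw [f.fderivWithin_zero hfix1 Z hZ] at h1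
    exact (toEntries d n).hasFDerivAt.comp_hasDerivAt (0 : ℂ) h1
  have hdiff : DifferentiableOn ℂ φ (Metric.ball 0 1) :=
    (toEntries d n).differentiable.comp_differentiableOn
      ((f.holo n).comp (fun t _ => (hasDerivAt_ray Z t).differentiableAt.differentiableWithinAt) hmem)
  have hmaps : Set.MapsTo φ (Metric.ball 0 1) (Metric.closedBall (φ 0) √n) := by
    intro t ht
    rw [hφ0, mem_closedBall_zero_iff]
    exact Real.le_sqrt_of_sq_le (norm_toEntries_sq_lt hn (f.mapsTo n (hmem t ht))).le
  have hnorm : ‖toEntries d n Z‖ = √n := by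
    have h := trace_sum_mul_conjTranspose Z
    rw [hiso, trace_one, Fintype.card_fin] at h
    rw [eq_comm, Real.sqrt_eq_iff_eq_sq (by positivity) (norm_nonneg _)]
    exact_mod_cast h
  have h := Complex.affine_of_mapsTo_ball_of_norm_dslope_eq_div hdiff hmaps
    (Metric.mem_ball_self one_pos) (by rw [dslope_same, hder.deriv, hnorm, div_one])
    (show t ∈ Metric.ball (0 : ℂ) 1 by simpa using ht)
  simp only [hφ0, dslope_same, hder.deriv, zero_add, sub_zero] at h
  apply toEntries_injective
  rw [map_smul]
  exact h

end NCSelfMap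

/-- The tuple whose `j`-th coordinate is `X j ⊕ δ_{jl}`, with in addition `s • b` placed in
the upper right corner of the `k`-th coordinate. -/
def dilation {d n : ℕ} (k l : Fin d) (X : MatTuple d n) (b : Matrix (Fin n) (Fin n) ℂ) (s : ℂ) :
    MatTuple d (n + n) :=
  fun j => Matrix.reindex finSumFinEquiv finSumFinEquiv
    (Matrix.fromBlocks (X j) (if j = k then s • b else 0) 0 (if j = l then 1 else 0))

lemma sum_fromBlocks_diag {ι : Type*} (s : Finset ι) {n : ℕ} (A D : ι → Matrix (Fin n) (Fin n) ℂ) :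
    ∑ j ∈ s, Matrix.fromBlocks (A j) 0 0 (D j) =
      Matrix.fromBlocks (∑ j ∈ s, A j) 0 0 (∑ j ∈ s, D j) := by
  ext x y
  rcases x with x | x <;> rcases y with y | y <;> simp [Matrix.sum_apply]

lemma dilation_gram {d n : ℕ} {k l : Fin d} (hkl : k ≠ l) {X : MatTuple d n}
    {b : Matrix (Fin n) (Fin n) ℂ} (hb : 1 - ∑ j, X j * (X j)ᴴ = b * bᴴ) (s : ℂ) :
    1 - ∑ j, dilation k l X b s j * (dilation k l X b s j)ᴴ =
      (1 - ‖s‖ ^ 2) • Matrix.reindex finSumFinEquiv finSumFinEquiv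
        (Matrix.fromBlocks (b * bᴴ) 0 0 (0 : Matrix (Fin n) (Fin n) ℂ)) := by
  let Φ := Matrix.reindexLinearEquiv ℝ ℂ (finSumFinEquiv (m := n) (n := n))
    (finSumFinEquiv (m := n) (n := n))
  have h1 : ∀ j, dilation k l X b s j * (dilation k l X b s j)ᴴ =
      Φ (Matrix.fromBlocks (X j * (X j)ᴴ + if j = k then (‖s‖ ^ 2) • (b * bᴴ) else 0) 0 0
        (if j = l then 1 else 0)) := by
    intro j
    simp only [Φ, dilation, reindex_apply, conjTranspose_submatrix, submatrix_mul_equiv,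
      fromBlocks_conjTranspose, fromBlocks_multiply, coe_reindexLinearEquiv]
    have hs : (s • b) * (s • b)ᴴ = (‖s‖ ^ 2) • (b * bᴴ) := by
      rw [conjTranspose_smul, smul_mul_smul_comm, ← Complex.coe_smul]
      congr 1
      simpa using Complex.mul_conj' s
    by_cases hk : j = k
    · simp only [hk, hkl, if_true, if_false, hs]
      simp
    · by_cases hl : j = l <;> simp [hk, hl, hkl.symm]
  have h2 : (1 : Matrix (Fin (n + n)) (Fin (n + n)) ℂ) = Φ (Matrix.fromBlocks 1 0 0 1) := by
    simp [Φ]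
  have h3 : (1 : Matrix (Fin n) (Fin n) ℂ) = ∑ j, X j * (X j)ᴴ + b * bᴴ := by
    rw [← hb]
    abel
  change _ = (1 - ‖s‖ ^ 2) • Φ (Matrix.fromBlocks (b * bᴴ) 0 0 0)
  simp only [h1]
  rw [h2, ← map_sum, sum_fromBlocks_diag, ← map_sub, ← map_smul, fromBlocks_smul]
  congr 1
  rw [sub_eq_add_neg, fromBlocks_neg, fromBlocks_add]
  simp only [Finset.sum_add_distrib, Finset.sum_ite_eq', Finset.mem_univ, if_true]
  congr 1
  · rw [h3]
    module
  all_goals simp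

lemma dilation_mem_closedFreeBall {d n : ℕ} {k l : Fin d} (hkl : k ≠ l) {X : MatTuple d n}
    {b : Matrix (Fin n) (Fin n) ℂ} (hb : 1 - ∑ j, X j * (X j)ᴴ = b * bᴴ) {s : ℂ} (hs : ‖s‖ ≤ 1) :
    dilation k l X b s ∈ closedFreeBall d (n + n) := by
  have h := Matrix.posSemidef_self_mul_conjTranspose
    (Matrix.fromBlocks b 0 0 (0 : Matrix (Fin n) (Fin n) ℂ))
  simp only [fromBlocks_conjTranspose, fromBlocks_multiply, conjTranspose_zero, mul_zero, zero_mul,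
    add_zero] at h
  rw [closedFreeBall, Set.mem_ofPred_eq, dilation_gram hkl hb]
  exact (h.submatrix _).smul (by nlinarith [norm_nonneg s])

lemma continuous_dilation {d n : ℕ} (k l : Fin d) (X : MatTuple d n)
    (b : Matrix (Fin n) (Fin n) ℂ) : Continuous (dilation k l X b) := by
  refine continuous_pi fun j => Continuous.matrix_reindex (Continuous.matrix_fromBlocks
    continuous_const ?_ continuous_const continuous_const) _ _
  split_ifs
  · exact continuous_id.smul continuous_const
  · exact continuous_const

lemma smul_dilation_zero {d n : ℕ} (k l : Fin d) (X : MatTuple d n)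
    (b : Matrix (Fin n) (Fin n) ℂ) (t : ℂ) :
    t • dilation k l X b 0 = dSum (t • X) (t • (Pi.single l 1 : MatTuple d n)) := by
  funext j
  have h : (Pi.single l 1 : MatTuple d n) j = if j = l then 1 else 0 := Pi.single_apply ..
  have hblocks : Matrix.fromBlocks (t • X j) 0 0
      (t • if j = l then (1 : Matrix (Fin n) (Fin n) ℂ) else 0) =
      t • Matrix.fromBlocks (X j) 0 0 (if j = l then 1 else 0) := by
    rw [fromBlocks_smul, smul_zero]
  simp only [Pi.smul_apply, dilation, dSum, zero_smul, ite_self, h, hblocks]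
  rfl

/-- The invertible matrix `1 ⊕ s`. -/
def blockScaling (n : ℕ) (s : ℂ) : Matrix (Fin (n + n)) (Fin (n + n)) ℂ :=
  Matrix.reindex finSumFinEquiv finSumFinEquiv (Matrix.fromBlocks 1 0 0 (s • 1))

lemma blockScaling_inv_mul {n : ℕ} {s : ℂ} (hs : s ≠ 0) :
    blockScaling n s⁻¹ * blockScaling n s = 1 := by
  simp [blockScaling, fromBlocks_multiply, hs]

lemma blockScaling_conj_dilation {d n : ℕ} (k l : Fin d) (X : MatTuple d n)
    (b : Matrix (Fin n) (Fin n) ℂ) {s : ℂ} (hs : s ≠ 0) (t : ℂ) :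
    (fun j => (blockScaling n s)⁻¹ * (t • dilation k l X b 1) j * blockScaling n s) =
      t • dilation k l X b s := by
  funext j
  rw [inv_eq_left_inv (blockScaling_inv_mul hs), Pi.smul_apply, mul_smul_comm,
    smul_mul_assoc, Pi.smul_apply]
  congr 1
  simp only [blockScaling, dilation, reindex_apply, submatrix_mul_equiv, fromBlocks_multiply]
  simp [hs]

/-- if an nc self-map fixes every level-1 point supported on the first `m`
coordinates (`2 ≤ m ≤ d`), then it fixes every such point on every level. -/
theorem stmt_4 {d m : ℕ} (f : NCSelfMap d) (hm2 : 2 ≤ m) (hmd : m ≤ d)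
    (hfix1 : ∀ v ∈ freeBall d 1, (∀ j : Fin d, m ≤ (j : ℕ) → v j = 0) → f.app 1 v = v) :
    ∀ n : ℕ, 1 ≤ n → ∀ X ∈ freeBall d n, (∀ j : Fin d, m ≤ (j : ℕ) → X j = 0) →
      f.app n X = X := by
  intro n hn X hX hX0
  obtain ⟨b, hb⟩ := exists_eq_mul_conjTranspose (Matrix.PosDef.posSemidef hX)
  let k : Fin d := ⟨0, by omega⟩
  let l : Fin d := ⟨1, by omega⟩
  have hkl : k ≠ l := by simp [k, l]
  have hiso : ∑ j, dilation k l X b 1 j * (dilation k l X b 1 j)ᴴ = 1 := by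
    have h := dilation_gram hkl hb 1
    rw [norm_one, one_pow, sub_self, zero_smul] at h
    exact (sub_eq_zero.1 h).symm
  have hsupp : ∀ j : Fin d, m ≤ (j : ℕ) → dilation k l X b 1 j = 0 := by
    intro j hj
    have hjk : j ≠ k := by rintro rfl; simp [k] at hj; omega
    have hjl : j ≠ l := by rintro rfl; simp [l] at hj; omega
    simp [dilation, hjk, hjl, hX0 j hj]
  have hXc := freeBall_subset_closedFreeBall d n hX
  have hscale : ∀ t : ℂ, ‖t‖ < 1 → f.app n (t • X) = t • X := by
    intro t ht
    have hmem : ∀ s : ℝ, s ∈ Set.Icc (0 : ℝ) 1 → t • dilation k l X b s ∈ freeBall d (n + n) :=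
      fun s hs => smul_mem_freeBall (dilation_mem_closedFreeBall hkl hb
        (by rw [Complex.norm_real, Real.norm_of_nonneg hs.1]; exact hs.2)) ht
    have h1 : f.app (n + n) (t • dilation k l X b 1) = t • dilation k l X b 1 :=
      f.app_smul_coisometry hfix1 (by omega) _ hsupp hiso ht
    have h2 := f.app_eq_of_path (fun s : ℝ => t • dilation k l X b s)
      (((continuous_dilation k l X b).comp Complex.continuous_ofReal).const_smul t)
      (fun s hs => hmem s ⟨hs.1, hs.2.le⟩) (fun s hs => by
        have hs0 : (s : ℂ) ≠ 0 := by exact_mod_cast hs.1.ne'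
        have hconj := blockScaling_conj_dilation k l X b hs0 t
        have h := f.map_sim (t • dilation k l X b 1) (blockScaling n s)
          (by simpa using hmem 1 (by simp))
          (IsUnit.of_mul_eq_one_right _ (blockScaling_inv_mul hs0))
          (by rw [hconj]; exact hmem s ⟨hs.1.le, hs.2.le⟩)
        rwa [h1, hconj] at h)
    have hC : (Pi.single l 1 : MatTuple d n) ∈ closedFreeBall d n := by
      simpa only [closedFreeBall, Set.mem_ofPred_eq, single_gram, conjTranspose_one, mul_one,
        sub_self] using Matrix.PosSemidef.zero
    simp only [Complex.ofReal_zero, smul_dilation_zero] at h2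
    rw [f.map_dSum _ _ (smul_mem_freeBall hXc ht) (smul_mem_freeBall hC ht)] at h2
    exact dSum_left_injective h2
  have hnorm : ∀ s ∈ Set.Ioo (0 : ℝ) 1, ‖((1 - s : ℝ) : ℂ)‖ < 1 := fun s hs => by
    rw [Complex.norm_real, Real.norm_of_nonneg (by linarith [hs.2])]
    linarith [hs.1]
  have h := f.app_eq_of_path (fun s : ℝ => ((1 - s : ℝ) : ℂ) • X)
    ((Complex.continuous_ofReal.comp (continuous_const.sub continuous_id)).smul continuous_const)
    (fun s hs => by
      rcases hs.1.eq_or_lt with rfl | h0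
      · simpa using hX
      · exact smul_mem_freeBall hXc (hnorm s ⟨h0, hs.2⟩))
    (fun s hs => hscale _ (hnorm s hs))
  simpa using h
end
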